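/- Let A ∈ ℝ^{d×d}, and let P, Q be real symmetric positive definite d×d matrices satisfying the Lyapunov equation Aᵀ P + P A = −Q. Then for every ξ ∈ ℝ^d and every t ≥ 0, ⟨P exp(A t) ξ, exp(A t) ξ⟩ ≥ exp(−(λ_max(Q)/λ_min(P)) · t) · ⟨P ξ, ξ⟩. -/

import Mathlib

open Matrix

attribute [local instance] Matrix.linftyOpNormedRing Matrix.linftyOpNormedAlgebra

/-- The smallest eigenvalue of a real matrix, i.e. the infimum of its real spectrum. -/
noncomputable def lamMin {d : ℕ} (M : Matrix (Fin d) (Fin d) ℝ) : ℝ :=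
  sInf (spectrum ℝ M)

/-- The largest eigenvalue of a real matrix, i.e. the supremum of its real spectrum. -/
noncomputable def lamMax {d : ℕ} (M : Matrix (Fin d) (Fin d) ℝ) : ℝ :=
  sSup (spectrum ℝ M)

open scoped Pointwise in
/-- The lower Rayleigh bound for a real symmetric matrix. -/
theorem lamMin_mul_dotProduct_le {d : ℕ} {M : Matrix (Fin d) (Fin d) ℝ} (hM : M.IsHermitian)
    (x : Fin d → ℝ) : lamMin M * (x ⬝ᵥ x) ≤ M *ᵥ x ⬝ᵥ x := by
  have h : (M - algebraMap ℝ _ (lamMin M)).PosSemidef := by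
    refine posSemidef_iff_isHermitian_and_spectrum_nonneg.2 ⟨hM.sub ?_, ?_⟩
    · simp [IsHermitian, Matrix.algebraMap_eq_diagonal]
    · rw [← spectrum.sub_singleton_eq]
      rintro _ ⟨a, ha, b, rfl, rfl⟩
      exact sub_nonneg.2 (csInf_le M.finite_real_spectrum.bddBelow ha)
  have := h.dotProduct_mulVec_nonneg x
  rw [sub_mulVec, dotProduct_sub, Algebra.algebraMap_eq_smul_one, smul_mulVec, one_mulVec,
    dotProduct_smul, star_trivial, smul_eq_mul, dotProduct_comm x (M *ᵥ x)] at this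
  linarith

open scoped Pointwise in
/-- The upper Rayleigh bound for a real symmetric matrix. -/
theorem dotProduct_le_lamMax_mul {d : ℕ} {M : Matrix (Fin d) (Fin d) ℝ} (hM : M.IsHermitian)
    (x : Fin d → ℝ) : M *ᵥ x ⬝ᵥ x ≤ lamMax M * (x ⬝ᵥ x) := by
  have h : (algebraMap ℝ _ (lamMax M) - M).PosSemidef := by
    refine posSemidef_iff_isHermitian_and_spectrum_nonneg.2 ⟨IsHermitian.sub ?_ hM, ?_⟩
    · simp [IsHermitian, Matrix.algebraMap_eq_diagonal]
    · rw [← spectrum.singleton_sub_eq]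
      rintro _ ⟨b, rfl, a, ha, rfl⟩
      exact sub_nonneg.2 (le_csSup M.finite_real_spectrum.bddAbove ha)
  have := h.dotProduct_mulVec_nonneg x
  rw [sub_mulVec, dotProduct_sub, Algebra.algebraMap_eq_smul_one, smul_mulVec, one_mulVec,
    dotProduct_smul, star_trivial, smul_eq_mul, dotProduct_comm x (M *ᵥ x)] at this
  linarith

/-- The eigenvalues of a positive definite matrix are positive. -/
theorem Matrix.PosDef.pos_of_mem_spectrum {d : ℕ} {M : Matrix (Fin d) (Fin d) ℝ} (hM : M.PosDef)
    {a : ℝ} (ha : a ∈ spectrum ℝ M) : 0 < a := by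
  rw [hM.isHermitian.spectrum_real_eq_range_eigenvalues] at ha
  obtain ⟨i, rfl⟩ := ha
  exact hM.eigenvalues_pos i

theorem lamMin_pos {d : ℕ} [NeZero d] {M : Matrix (Fin d) (Fin d) ℝ} (hM : M.PosDef) :
    0 < lamMin M :=
  hM.pos_of_mem_spectrum <| Set.Nonempty.csInf_mem
    ⟨_, hM.isHermitian.eigenvalues_mem_spectrum_real 0⟩ M.finite_real_spectrum

theorem lamMax_nonneg {d : ℕ} {M : Matrix (Fin d) (Fin d) ℝ} (hM : M.PosDef) : 0 ≤ lamMax M :=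
  Real.sSup_nonneg fun _ ha => (hM.pos_of_mem_spectrum ha).le

theorem HasDerivAt.dotProduct {d : ℕ} {u v : ℝ → Fin d → ℝ} {u' v' : Fin d → ℝ} {t : ℝ}
    (hu : HasDerivAt u u' t) (hv : HasDerivAt v v' t) :
    HasDerivAt (fun s => u s ⬝ᵥ v s) (u' ⬝ᵥ v t + u t ⬝ᵥ v') t := by
  simp only [_root_.dotProduct, ← Finset.sum_add_distrib]
  exact HasDerivAt.fun_sum fun i _ => (hasDerivAt_pi.1 hu i).mul (hasDerivAt_pi.1 hv i)

theorem HasDerivAt.const_mulVec {d : ℕ} (M : Matrix (Fin d) (Fin d) ℝ) {u : ℝ → Fin d → ℝ}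
    {u' : Fin d → ℝ} {t : ℝ} (hu : HasDerivAt u u' t) :
    HasDerivAt (fun s => M *ᵥ u s) (M *ᵥ u') t :=
  M.mulVecLin.toContinuousLinearMap.hasFDerivAt.comp_hasDerivAt t hu

/-- The curve `t ↦ exp(At) ξ` is an integral curve of the linear vector field `A`. -/
theorem hasDerivAt_exp_smul_mulVec {d : ℕ} (A : Matrix (Fin d) (Fin d) ℝ) (ξ : Fin d → ℝ) (t : ℝ) :
    HasDerivAt (fun s : ℝ => NormedSpace.exp (s • A) *ᵥ ξ)
      (A *ᵥ (NormedSpace.exp (t • A) *ᵥ ξ)) t := by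
  have h := hasDerivAt_exp_smul_const' (𝕂 := ℝ) A t
  rw [mulVec_mulVec]
  exact ((Matrix.mulVecBilin ℝ ℝ).flip ξ).toContinuousLinearMap.hasFDerivAt.comp_hasDerivAt t h

/-- Along the flow of `A`, the quadratic form of `P` has derivative `-⟨Q γ, γ⟩`. -/
theorem hasDerivAt_lyapunov {d : ℕ} {A P Q : Matrix (Fin d) (Fin d) ℝ}
    (hLyap : Aᵀ * P + P * A = -Q) {γ : ℝ → Fin d → ℝ} {t : ℝ}
    (hγ : HasDerivAt γ (A *ᵥ γ t) t) :
    HasDerivAt (fun s => P *ᵥ γ s ⬝ᵥ γ s) (-(Q *ᵥ γ t ⬝ᵥ γ t)) t := by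
  convert (hγ.const_mulVec P).dotProduct hγ using 1
  rw [← neg_dotProduct, ← neg_mulVec, ← hLyap, add_mulVec, add_dotProduct, add_comm,
    mulVec_mulVec, ← mulVec_mulVec (γ t) Aᵀ P, mulVec_transpose, ← dotProduct_mulVec]

/-- **Fact.**  If `P, Q` are symmetric positive definite and `Aᵀ P + P A = −Q`, then along
the flow `t ↦ exp(At) ξ` of `γ' = Aγ` one has
`⟨P exp(At) ξ, exp(At) ξ⟩ ≥ exp(−(λ_max(Q)/λ_min(P)) t) ⟨P ξ, ξ⟩` for all `t ≥ 0`. -/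
theorem lyapunov_flow_lower_bound
    {d : ℕ} (A P Q : Matrix (Fin d) (Fin d) ℝ)
    (hP : P.PosDef) (hQ : Q.PosDef)
    (hLyap : Aᵀ * P + P * A = -Q) :
    ∀ ξ : Fin d → ℝ, ∀ t : ℝ, 0 ≤ t →
      Real.exp (-(lamMax Q / lamMin P) * t) * (P.mulVec ξ ⬝ᵥ ξ) ≤
        P.mulVec ((NormedSpace.exp (t • A)).mulVec ξ) ⬝ᵥ
          (NormedSpace.exp (t • A)).mulVec ξ := by
  intro ξ t ht
  rcases Nat.eq_zero_or_pos d with rfl | hd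
  · simp [dotProduct]
  have : NeZero d := ⟨hd.ne'⟩
  set c := lamMax Q / lamMin P with hc
  set γ : ℝ → Fin d → ℝ := fun s => NormedSpace.exp (s • A) *ᵥ ξ with hγ
  have hpos := lamMin_pos hP
  have hc0 : 0 ≤ c := div_nonneg (lamMax_nonneg hQ) hpos.le
  have hbound (x : Fin d → ℝ) : Q *ᵥ x ⬝ᵥ x ≤ c * (P *ᵥ x ⬝ᵥ x) :=
    calc Q *ᵥ x ⬝ᵥ x ≤ lamMax Q * (x ⬝ᵥ x) := dotProduct_le_lamMax_mul hQ.isHermitian x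
      _ = c * (lamMin P * (x ⬝ᵥ x)) := by rw [hc]; field_simp
      _ ≤ c * (P *ᵥ x ⬝ᵥ x) :=
        mul_le_mul_of_nonneg_left (lamMin_mul_dotProduct_le hP.isHermitian x) hc0
  have hderiv (s : ℝ) : HasDerivAt (fun s => Real.exp (c * s) * (P *ᵥ γ s ⬝ᵥ γ s))
      (Real.exp (c * s) * (c * 1) * (P *ᵥ γ s ⬝ᵥ γ s) +
        Real.exp (c * s) * -(Q *ᵥ γ s ⬝ᵥ γ s)) s :=
    ((hasDerivAt_id s).const_mul c).exp.mul
      (hasDerivAt_lyapunov hLyap (hasDerivAt_exp_smul_mulVec A ξ s))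
  have hmono : Monotone fun s => Real.exp (c * s) * (P *ᵥ γ s ⬝ᵥ γ s) :=
    monotone_of_hasDerivAt_nonneg hderiv fun s => by
      have := mul_nonneg (Real.exp_pos (c * s)).le (sub_nonneg.2 (hbound (γ s)))
      simp only [Pi.zero_apply]
      linarith
  have h0 : γ 0 = ξ := by simp [hγ]
  have h := hmono ht
  simp only [mul_zero, Real.exp_zero, one_mul, h0] at h
  rw [neg_mul, Real.exp_neg, inv_mul_le_iff₀ (Real.exp_pos _)]
  exact h
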